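/- arXiv:2601.08407 — 3 statements merged into one kernel-verified Lean document; each statement's English description precedes it below -/
import Mathlib

section
/- Let X be a compact metric space and f : X → X a continuous map. For every shadowable point x of f, the following are equivalent: (i) x is a lower semicontinuity point of the ω-limit set map ω_f; (ii) ω_f(x) ⊆ ω_f(y) for every y ∈ Ω_f(x). -/
open Filter Topology

variable {X : Type*} [MetricSpace X]

/-- The ω-limit set of `x` under `f`: points `y` with `f^[φ j] x → y` for some
strictly increasing sequence `φ`. -/
def omegaLimitPt (f : X → X) (x : X) : Set X :=
  {y | ∃ φ : ℕ → ℕ, StrictMono φ ∧ Tendsto (fun j => f^[φ j] x) atTop (𝓝 y)}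

/-- The set `Ω_f(x)`: points `y` such that there are `x_j → x` and a strictly
increasing sequence `φ` with `f^[φ j] (x_j) → y`. -/
def bigOmega (f : X → X) (x : X) : Set X :=
  {y | ∃ (xs : ℕ → X) (φ : ℕ → ℕ), StrictMono φ ∧
    Tendsto xs atTop (𝓝 x) ∧ Tendsto (fun j => f^[φ j] (xs j)) atTop (𝓝 y)}

/-- `x` is a shadowable point for `f`. -/
def ShadowablePoint (f : X → X) (x : X) : Prop :=
  ∀ ε > 0, ∃ δ > 0, ∀ xs : ℕ → X, (∀ i, dist (f (xs i)) (xs (i + 1)) ≤ δ) →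
    xs 0 = x → ∃ y, ∀ i, dist (xs i) (f^[i] y) ≤ ε

/-- `x` is an upper semicontinuity point of the ω-limit set map. -/
def USCPoint (f : X → X) (x : X) : Prop :=
  ∀ U : Set X, IsOpen U → omegaLimitPt f x ⊆ U →
    ∃ δ > 0, ∀ y, dist x y ≤ δ → omegaLimitPt f y ⊆ U

/-- `x` is a lower semicontinuity point of the ω-limit set map. -/
def LSCPoint (f : X → X) (x : X) : Prop :=
  ∀ U : Set X, IsOpen U → (omegaLimitPt f x ∩ U).Nonempty →
    ∃ δ > 0, ∀ y, dist x y ≤ δ → (omegaLimitPt f y ∩ U).Nonempty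

/-- `(c i)_{i=0}^k` is a `δ`-chain of `f` (with `k ≥ 1`). -/
def IsDeltaChain (f : X → X) (δ : ℝ) (c : ℕ → X) (k : ℕ) : Prop :=
  1 ≤ k ∧ ∀ i < k, dist (f (c i)) (c (i + 1)) ≤ δ

/-- `y → z`: for every `δ > 0` there is a `δ`-chain of `f` from `y` to `z`. -/
def ChainReach (f : X → X) (y z : X) : Prop :=
  ∀ δ > 0, ∃ (c : ℕ → X) (k : ℕ), IsDeltaChain f δ c k ∧ c 0 = y ∧ c k = z

/-- A set `S` is chain stable: `y ∈ S` and `y → z` imply `z ∈ S`. -/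
def ChainStable (f : X → X) (S : Set X) : Prop :=
  ∀ y ∈ S, ∀ z, ChainReach f y z → z ∈ S

/-- The set `ω_f*(x)`: points reachable from `x` by arbitrarily fine and
arbitrarily long `δ`-chains. -/
def omegaStar (f : X → X) (x : X) : Set X :=
  {y | ∀ δ > 0, ∀ l : ℕ, 1 ≤ l → ∃ (c : ℕ → X) (k : ℕ),
    l ≤ k ∧ IsDeltaChain f δ c k ∧ c 0 = x ∧ c k = y}

/-- The chain component of a point `p`. -/
def chainComponent (f : X → X) (p : X) : Set X :=
  {q | ChainReach f p q ∧ ChainReach f q p}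

/-- `f` is chain continuous at `x`. -/
def ChainContinuousAt (f : X → X) (x : X) : Prop :=
  ∀ ε > 0, ∃ δ > 0, ∀ xs : ℕ → X, (∀ i, dist (f (xs i)) (xs (i + 1)) ≤ δ) →
    xs 0 = x → ∀ i, dist (xs i) (f^[i] x) ≤ ε

/-- The chain recurrent set `CR(f)`. -/
def chainRecurrent (f : X → X) : Set X := {x | ChainReach f x x}

/-- `x` is a regularly recurrent point for `f`. -/
def RegularlyRecurrent (f : X → X) (x : X) : Prop :=
  ∀ ε > 0, ∃ k : ℕ, 1 ≤ k ∧ ∀ j : ℕ, dist x (f^[j * k] x) ≤ ε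

/-- `M` is a minimal set for `f`. -/
def IsMinimalSet (f : X → X) (M : Set X) : Prop :=
  M.Nonempty ∧ IsClosed M ∧ f '' M ⊆ M ∧ ∀ y ∈ M, omegaLimitPt f y = M

theorem mem_omegaLimitPt_iff_mapClusterPt {f : X → X} {x y : X} :
    y ∈ omegaLimitPt f x ↔ MapClusterPt y atTop (fun n => f^[n] x) := by
  constructor
  · rintro ⟨φ, hφ, h⟩
    exact h.mapClusterPt.of_comp hφ.tendsto_atTop
  · intro h
    exact h.tendsto_subseq

theorem LSCPoint.omegaLimitPt_subset {f : X → X} (hf : Continuous f) {x y : X}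
    (hx : ShadowablePoint f x) (hl : LSCPoint f x) (hy : y ∈ bigOmega f x) :
    omegaLimitPt f x ⊆ omegaLimitPt f y := by
  intro z hz
  rw [mem_omegaLimitPt_iff_mapClusterPt, Metric.nhds_basis_ball.mapClusterPt_iff_frequently]
  intro ε hε
  obtain ⟨δ₀, hδ₀, hlsc⟩ := hl (Metric.ball z (ε / 2)) Metric.isOpen_ball
    ⟨z, hz, Metric.mem_ball_self (half_pos hε)⟩
  obtain ⟨δ, hδ, hsh⟩ := hx (min δ₀ (ε / 2)) (lt_min hδ₀ (half_pos hε))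
  obtain ⟨xs, φ, hφ, hxs, hlim⟩ := hy
  have h1 : ∀ᶠ j in atTop, dist (f (xs j)) (f x) < δ :=
    (Metric.tendsto_nhds.1 ((hf.tendsto x).comp hxs)) δ hδ
  have h2 : ∀ᶠ j in atTop, dist (f^[φ j] (xs j)) y < δ := Metric.tendsto_nhds.1 hlim δ hδ
  obtain ⟨j, hj1, hj2, hj3⟩ := (h1.and (h2.and (hφ.tendsto_atTop.eventually_ge_atTop 2))).exists
  obtain ⟨w, hw⟩ := hsh
    (fun i => if i = 0 then x else if i < φ j then f^[i] (xs j) else f^[i - φ j] y) (by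
      intro i
      rcases Nat.eq_zero_or_pos i with rfl | hi
      · rw [if_pos rfl, if_neg (by lia), if_pos (by lia), dist_comm]
        exact hj1.le
      rw [if_neg hi.ne', if_neg (Nat.succ_ne_zero i)]
      rcases lt_trichotomy (i + 1) (φ j) with h | h | h
      · rw [if_pos (by lia), if_pos h, ← Function.iterate_succ_apply' f, dist_self]
        exact hδ.le
      · rw [if_pos (by lia), if_neg (by lia), ← Function.iterate_succ_apply' f,
          Nat.succ_eq_add_one, h, Nat.sub_self]
        exact hj2.le
      · rw [if_neg (by lia), if_neg (by lia), ← Function.iterate_succ_apply' f,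
          Nat.succ_eq_add_one, show i - φ j + 1 = i + 1 - φ j by lia, dist_self]
        exact hδ.le) (if_pos rfl)
  have hw0 : dist x w ≤ δ₀ := by simpa using (hw 0).trans (min_le_left _ _)
  obtain ⟨v, hv, hvz⟩ := hlsc w hw0
  have hfreq := (mem_omegaLimitPt_iff_mapClusterPt.1 hv).frequently
    (Metric.isOpen_ball.mem_nhds hvz)
  rw [frequently_atTop] at hfreq ⊢
  intro N
  obtain ⟨m, hm, hmz⟩ := hfreq (N + φ j)
  refine ⟨m - φ j, by lia, ?_⟩
  have hwm := (hw m).trans (min_le_right _ _)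
  rw [if_neg (by lia), if_neg (by lia)] at hwm
  rw [Metric.mem_ball]
  linarith [dist_triangle (f^[m - φ j] y) (f^[m] w) z]

theorem LSCPoint.of_omegaLimitPt_subset [CompactSpace X] {f : X → X} (hf : Continuous f) {x : X}
    (h : ∀ y ∈ bigOmega f x, omegaLimitPt f x ⊆ omegaLimitPt f y) : LSCPoint f x := by
  rintro U hU ⟨z, hz, hzU⟩
  by_contra! hcon
  obtain ⟨r, hr, hrU⟩ := Metric.nhds_basis_closedBall.mem_iff.1 (hU.mem_nhds hzU)
  choose w hxw hwU using fun n : ℕ => hcon (1 / ((n : ℝ) + 1)) Nat.one_div_pos_of_nat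
  have hev : ∀ n, ∀ᶠ k in atTop, ∀ m ≥ k, f^[m] (w n) ∉ Metric.closedBall z r := by
    intro n
    rw [eventually_forall_ge_atTop]
    by_contra hfreq
    have hfreq' : ∃ᶠ m in atTop, f^[m] (w n) ∈ Metric.closedBall z r := by
      simpa [Filter.Frequently] using hfreq
    obtain ⟨v, hv, hvc⟩ :=
      Metric.isClosed_closedBall.isCompact.exists_mapClusterPt_of_frequently hfreq'
    exact (hwU n).subset ⟨mem_omegaLimitPt_iff_mapClusterPt.2 hvc, hrU hv⟩
  obtain ⟨φ, hφ, hφw⟩ := extraction_forall_of_eventually hev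
  have hwx : Tendsto w atTop (𝓝 x) := by
    rw [tendsto_iff_dist_tendsto_zero]
    exact squeeze_zero (fun _ => dist_nonneg) (fun n => (dist_comm _ _).trans_le (hxw n))
      tendsto_one_div_add_atTop_nhds_zero_nat
  obtain ⟨y, ψ, hψ, hy⟩ := CompactSpace.tendsto_subseq fun n => f^[φ n] (w n)
  have hzy := h y ⟨w ∘ ψ, φ ∘ ψ, hφ.comp hψ, hwx.comp hψ.tendsto_atTop, hy⟩ hz
  obtain ⟨n, hn⟩ := ((mem_omegaLimitPt_iff_mapClusterPt.1 hzy).frequently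
    (Metric.ball_mem_nhds z hr)).exists
  obtain ⟨j, hj⟩ := ((((hf.iterate n).tendsto y).comp hy).eventually
    (Metric.isOpen_ball.mem_nhds hn)).exists
  refine hφw (ψ j) (n + φ (ψ j)) (Nat.le_add_left _ _) (Metric.ball_subset_closedBall ?_)
  rw [Function.iterate_add_apply]
  exact hj

theorem stmt4 [CompactSpace X] (f : X → X) (hf : Continuous f) (x : X)
    (hx : ShadowablePoint f x) :
    LSCPoint f x ↔ ∀ y ∈ bigOmega f x, omegaLimitPt f x ⊆ omegaLimitPt f y :=
  ⟨fun hl _ hy => hl.omegaLimitPt_subset hf hx hy, LSCPoint.of_omegaLimitPt_subset hf⟩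
end

section
/- Let X be a compact metric space and f : X → X a continuous map. Every point x ∈ X such that ω_f(x) ⊆ ω_f(y) for all y ∈ Ω_f(x) is a lower semicontinuity point of the ω-limit set map ω_f. -/
open Filter Topology

variable {X : Type*} [MetricSpace X]

theorem omegaLimitPt_nonempty [CompactSpace X] (f : X → X) (x : X) :
    (omegaLimitPt f x).Nonempty := by
  obtain ⟨y, φ, hφ, hy⟩ := CompactSpace.tendsto_subseq (fun n => f^[n] x)
  exact ⟨y, φ, hφ, hy⟩

theorem iterate_mem_omegaLimitPt {f : X → X} (hf : Continuous f) {x y : X}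
    (hy : y ∈ omegaLimitPt f x) (n : ℕ) : f^[n] y ∈ omegaLimitPt f x := by
  obtain ⟨φ, hφ, hlim⟩ := hy
  refine ⟨fun j => n + φ j, fun a b hab => Nat.add_lt_add_left (hφ hab) n, ?_⟩
  simpa only [Function.iterate_add_apply, Function.comp_def] using ((hf.iterate n).tendsto y).comp hlim

theorem frequently_dist_iterate_lt {f : X → X} {x y : X} (hy : y ∈ omegaLimitPt f x)
    {ε : ℝ} (hε : 0 < ε) : ∃ᶠ k in atTop, dist (f^[k] x) y < ε := by
  obtain ⟨φ, hφ, hlim⟩ := hy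
  exact hφ.tendsto_atTop.frequently (Metric.tendsto_nhds.1 hlim ε hε).frequently

/-- Limits of points of `omegaLimitPt f (xs j)` with `xs j → x` lie in `bigOmega f x`. -/
theorem mem_bigOmega_of_tendsto {f : X → X} {x z : X} {xs zs : ℕ → X}
    (hxs : Tendsto xs atTop (𝓝 x)) (hzs : Tendsto zs atTop (𝓝 z))
    (hmem : ∀ j, zs j ∈ omegaLimitPt f (xs j)) : z ∈ bigOmega f x := by
  obtain ⟨φ, hφ, hdist⟩ := extraction_forall_of_frequently fun j : ℕ =>
    frequently_dist_iterate_lt (hmem j) (Nat.one_div_pos_of_nat (α := ℝ) (n := j))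
  refine ⟨xs, φ, hφ, hxs, ?_⟩
  refine (tendsto_iff_of_dist ?_).2 hzs
  exact squeeze_zero (fun _ => dist_nonneg) (fun j => (hdist j).le)
    tendsto_one_div_add_atTop_nhds_zero_nat

theorem stmt5 [CompactSpace X] (f : X → X) (hf : Continuous f) (x : X)
    (hx : ∀ y ∈ bigOmega f x, omegaLimitPt f x ⊆ omegaLimitPt f y) :
    LSCPoint f x := by
  intro U hU ⟨p, hpx, hpU⟩
  by_contra! hcon
  choose xs hxs hempty using fun j : ℕ =>
    hcon (1 / ((j : ℝ) + 1)) Nat.one_div_pos_of_nat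
  choose zs hzs using fun j => omegaLimitPt_nonempty f (xs j)
  have hxlim : Tendsto xs atTop (𝓝 x) := by
    rw [tendsto_iff_dist_tendsto_zero]
    exact squeeze_zero (fun _ => dist_nonneg) (fun j => dist_comm x (xs j) ▸ hxs j)
      tendsto_one_div_add_atTop_nhds_zero_nat
  obtain ⟨z, ψ, hψ, hz⟩ := CompactSpace.tendsto_subseq zs
  have hzx : z ∈ bigOmega f x :=
    mem_bigOmega_of_tendsto (hxlim.comp hψ.tendsto_atTop) hz fun j => hzs (ψ j)
  obtain ⟨φ, -, hlim⟩ := hx z hzx hpx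
  obtain ⟨m, hm⟩ := (hlim.eventually (hU.mem_nhds hpU)).exists
  obtain ⟨j, hj⟩ := ((((hf.iterate (φ m)).tendsto z).comp hz).eventually
    (hU.mem_nhds hm)).exists
  exact (hempty (ψ j)).le ⟨iterate_mem_omegaLimitPt hf (hzs (ψ j)) (φ m), hj⟩
end

section
/- Let X be a compact metric space and f : X → X a continuous map such that every point of X is a shadowable point for f. Then every point of X is a lower semicontinuity point of the ω-limit set map ω_f if and only if f is chain continuous at every point of X. -/
open Filter Topology

variable {X : Type*} [MetricSpace X]

section OmegaLimit

variable {f : X → X}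

theorem mem_omegaLimitPt_iff {x y : X} :
    y ∈ omegaLimitPt f x ↔ ∀ ε > 0, ∀ N : ℕ, ∃ n ≥ N, dist (f^[n] x) y < ε := by
  constructor
  · rintro ⟨φ, hφ, hlim⟩ ε hε N
    obtain ⟨j, hj, hjN⟩ :=
      ((Metric.tendsto_nhds.1 hlim ε hε).and (eventually_ge_atTop N)).exists
    exact ⟨φ j, hjN.trans (hφ.id_le j), hj⟩
  · intro h
    have hc : MapClusterPt y atTop (fun n => f^[n] x) := by
      rw [Metric.nhds_basis_ball.mapClusterPt_iff_frequently]
      intro ε hε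
      exact frequently_atTop.2 fun N => h ε hε N
    exact hc.tendsto_subseq

theorem mem_omegaLimitPt_of_forall_dist_lt {x u : X}
    (h : ∀ ε > 0, ∃ b ∈ omegaLimitPt f x, dist u b < ε) : u ∈ omegaLimitPt f x := by
  rw [mem_omegaLimitPt_iff]
  intro ε hε N
  obtain ⟨b, hb, hub⟩ := h (ε / 2) (half_pos hε)
  obtain ⟨n, hn, hnb⟩ := mem_omegaLimitPt_iff.1 hb (ε / 2) (half_pos hε) N
  refine ⟨n, hn, ?_⟩
  have := dist_triangle_right (f^[n] x) u b
  linarith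

/-- Orbits that stay `ε`-close up to a time shift have `ε`-close ω-limit points. -/
theorem exists_mem_omegaLimitPt_dist_le [CompactSpace X] {y w a : X} {ε : ℝ} {k l : ℕ}
    (h : ∀ i, dist (f^[i + k] y) (f^[i + l] w) ≤ ε) (ha : a ∈ omegaLimitPt f y) :
    ∃ b ∈ omegaLimitPt f w, dist a b ≤ ε := by
  obtain ⟨φ, hφ, hlim⟩ := ha
  have hk : ∀ j, k ≤ φ (j + k) := fun j => le_trans (Nat.le_add_left k j) (hφ.id_le (j + k))
  obtain ⟨b, ψ, hψ, hb⟩ := CompactSpace.tendsto_subseq (fun j => f^[φ (j + k) - k + l] w)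
  refine ⟨b, ⟨fun j => φ (ψ j + k) - k + l, ?_, hb⟩, ?_⟩
  · intro i j hij
    have h1 : φ (ψ i + k) < φ (ψ j + k) := hφ (by have := hψ hij; omega)
    have h2 := hk (ψ i)
    show φ (ψ i + k) - k + l < φ (ψ j + k) - k + l
    omega
  · have hy : Tendsto (fun j => f^[φ (ψ j + k)] y) atTop (𝓝 a) :=
      hlim.comp ((tendsto_add_atTop_nat k).comp hψ.tendsto_atTop)
    refine le_of_tendsto (hy.dist hb) (Eventually.of_forall fun j => ?_)
    have := h (φ (ψ j + k) - k)
    rwa [Nat.sub_add_cancel (hk (ψ j))] at this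

/-- Limits along shifted times: a point of `ω_f(p)` inherits eventual closeness. -/
theorem exists_mem_omegaLimitPt_of_strictMono [CompactSpace X] (hf : Continuous f) (p : X)
    {t : ℕ → ℕ} (ht : StrictMono t) :
    ∃ q ∈ omegaLimitPt f p, ∀ (i : ℕ) (c : X) (η : ℝ),
      (∀ᶠ m in atTop, dist c (f^[t m + i] p) ≤ η) → dist c (f^[i] q) ≤ η := by
  obtain ⟨q, ψ, hψ, hq⟩ := CompactSpace.tendsto_subseq (fun m => f^[t m] p)
  refine ⟨q, ⟨t ∘ ψ, ht.comp hψ, hq⟩, fun i c η h => ?_⟩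
  have h1 : Tendsto (fun j => f^[i] (f^[t (ψ j)] p)) atTop (𝓝 (f^[i] q)) :=
    ((hf.iterate i).tendsto q).comp hq
  refine le_of_tendsto (tendsto_const_nhds.dist h1) ?_
  filter_upwards [hψ.tendsto_atTop.eventually h] with j hj
  rwa [add_comm, Function.iterate_add_apply] at hj

end OmegaLimit

section Chains

variable {f : X → X}

theorem IsDeltaChain.update_last {δ₁ δ₂ : ℝ} {c : ℕ → X} {n : ℕ} {v : X}
    (hc : IsDeltaChain f δ₁ c n) (hδ₂ : 0 ≤ δ₂) (hv : dist (c n) v ≤ δ₂) :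
    IsDeltaChain f (δ₁ + δ₂) (Function.update c n v) n := by
  refine ⟨hc.1, fun i hi => ?_⟩
  have h := hc.2 i hi
  rw [Function.update_of_ne hi.ne]
  rcases eq_or_ne (i + 1) n with h1 | h1
  · rw [h1] at h ⊢
    rw [Function.update_self]
    exact (dist_triangle _ (c n) _).trans (add_le_add h hv)
  · rw [Function.update_of_ne h1]
    linarith

theorem IsDeltaChain.append {δ : ℝ} {c₁ c₂ : ℕ → X} {n m : ℕ}
    (h₁ : IsDeltaChain f δ c₁ n) (h₂ : IsDeltaChain f δ c₂ m) (h : c₁ n = c₂ 0) :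
    ∃ c : ℕ → X, (∀ i ≤ n, c i = c₁ i) ∧ c (n + m) = c₂ m ∧ IsDeltaChain f δ c (n + m) := by
  have hm := h₂.1
  refine ⟨fun i => if i ≤ n then c₁ i else c₂ (i - n), fun i hi => if_pos hi, ?_, ?_, ?_⟩
  · simp [show ¬ n + m ≤ n by omega]
  · omega
  · intro i hi
    rcases lt_trichotomy i n with hin | rfl | hin
    · simpa [hin.le, Nat.succ_le_of_lt hin] using h₁.2 i hin
    · have := h₂.2 0 (by omega)
      simpa [h] using this
    · have := h₂.2 (i - n) (by omega)
      simpa [show ¬ i ≤ n by omega, show ¬ i + 1 ≤ n by omega,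
        show i + 1 - n = i - n + 1 by omega] using this

theorem isDeltaChain_iterate {δ : ℝ} (hδ : 0 ≤ δ) (x : X) {n : ℕ} (hn : 1 ≤ n) :
    IsDeltaChain f δ (fun i => f^[i] x) n :=
  ⟨hn, fun i _ => by simpa [Function.iterate_succ_apply'] using hδ⟩

theorem chainReach_of_mem_omegaLimitPt {x y : X} (h : y ∈ omegaLimitPt f x) :
    ChainReach f x y := by
  intro δ hδ
  obtain ⟨n, hn, hy⟩ := mem_omegaLimitPt_iff.1 h δ hδ 1
  refine ⟨Function.update (fun i => f^[i] x) n y, n, ?_, ?_, Function.update_self ..⟩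
  · simpa using (isDeltaChain_iterate le_rfl x hn).update_last hδ.le hy.le
  · rw [Function.update_of_ne (by omega)]
    rfl

/-- A point is chain reachable if it is a limit of endpoints of ever finer chains. -/
theorem exists_isDeltaChain_of_tendsto {x v : X} {c : ℕ → ℕ → X} {n : ℕ → ℕ} {e : ℕ → ℝ}
    (hc : ∀ k, IsDeltaChain f (e k) (c k) (n k)) (hx : ∀ k, c k 0 = x)
    (he : Tendsto e atTop (𝓝 0)) (hv : Tendsto (fun k => c k (n k)) atTop (𝓝 v))
    {δ : ℝ} (hδ : 0 < δ) :
    ∀ᶠ k in atTop, ∃ d : ℕ → X, IsDeltaChain f δ d (n k) ∧ d 0 = x ∧ d (n k) = v := by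
  filter_upwards [he.eventually (gt_mem_nhds (half_pos hδ)),
    Metric.tendsto_nhds.1 hv (δ / 2) (half_pos hδ)] with k hek hvk
  have h := (hc k).update_last (half_pos hδ).le hvk.le
  refine ⟨_, ⟨h.1, fun i hi => (h.2 i hi).trans (by linarith)⟩, ?_, Function.update_self ..⟩
  rw [Function.update_of_ne (by have := h.1; omega), hx]

theorem ChainReach.omegaLimitPt_subset [CompactSpace X] {x w : X}
    (hsh : ShadowablePoint f x) (hl : LSCPoint f x) (h : ChainReach f x w) :
    omegaLimitPt f x ⊆ omegaLimitPt f w := by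
  intro u hu
  refine mem_omegaLimitPt_of_forall_dist_lt fun ε hε => ?_
  obtain ⟨ρ, hρ, hlsc⟩ := hl (Metric.ball u (ε / 2)) Metric.isOpen_ball
    ⟨u, hu, Metric.mem_ball_self (half_pos hε)⟩
  obtain ⟨δ, hδ, hshδ⟩ := hsh (min ρ (ε / 2)) (lt_min hρ (half_pos hε))
  obtain ⟨c, k, hc, hc0, hck⟩ := h δ hδ
  obtain ⟨y, hy⟩ := hshδ (fun i => if i ≤ k then c i else f^[i - k] w)
    (fun i => by
      rcases lt_trichotomy i k with hik | rfl | hik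
      · simpa [hik.le, Nat.succ_le_of_lt hik] using hc.2 i hik
      · simpa [hck] using hδ.le
      · simpa [show ¬ i ≤ k by omega, show ¬ i + 1 ≤ k by omega,
          show i + 1 - k = i - k + 1 by omega, Function.iterate_succ_apply'] using hδ.le)
    (by simpa using hc0)
  obtain ⟨a, ha, hau⟩ := hlsc y (by simpa [hc0] using (hy 0).trans (min_le_left _ _))
  obtain ⟨b, hb, hab⟩ := exists_mem_omegaLimitPt_dist_le (k := k + 1) (l := 1) (w := w)
    (ε := ε / 2) (fun i => by
      have := (hy (i + (k + 1))).trans (min_le_right _ _)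
      rw [dist_comm]
      simpa [show ¬ i + (k + 1) ≤ k by omega, show i + (k + 1) - k = i + 1 by omega]
        using this) ha
  refine ⟨b, hb, ?_⟩
  have h1 := dist_triangle u a b
  rw [Metric.mem_ball, dist_comm] at hau
  linarith

/-- Shadowing an irregular concatenation of two cycles of equal length shows that they must be
close at all times, provided all ω-limit sets are minimal. -/
theorem dist_cycles_le [CompactSpace X] (hf : Continuous f)
    (hmin : ∀ p, ∀ q ∈ omegaLimitPt f p, omegaLimitPt f p ⊆ omegaLimitPt f q)
    {x : X} {η δ : ℝ} (hη : 0 < η)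
    (hsh : ∀ xs : ℕ → X, (∀ i, dist (f (xs i)) (xs (i + 1)) ≤ δ) →
      xs 0 = x → ∃ y, ∀ i, dist (xs i) (f^[i] y) ≤ η)
    {P Q : ℕ → X} {N : ℕ} (hP : IsDeltaChain f δ P N) (hQ : IsDeltaChain f δ Q N)
    (hP0 : P 0 = x) (hPN : P N = x) (hQ0 : Q 0 = x) (hQN : Q N = x) {n : ℕ} (hn : n < N) :
    dist (P n) (Q n) ≤ 6 * η := by
  classical
  have hN : 0 < N := hP.1
  set xs : ℕ → X := fun t => if IsSquare (t / N) then Q (t % N) else P (t % N) with hxs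
  have hxP : ∀ b i, i < N → ¬ IsSquare b → xs (b * N + i) = P i := by
    intro b i hi hb
    have h1 : (b * N + i) / N = b := by
      rw [mul_comm, Nat.mul_add_div hN, Nat.div_eq_of_lt hi, add_zero]
    have h2 : (b * N + i) % N = i := by
      rw [mul_comm, Nat.mul_add_mod, Nat.mod_eq_of_lt hi]
    simp [hxs, h1, h2, hb]
  have hxQ : ∀ b i, i < N → IsSquare b → xs (b * N + i) = Q i := by
    intro b i hi hb
    have h1 : (b * N + i) / N = b := by
      rw [mul_comm, Nat.mul_add_div hN, Nat.div_eq_of_lt hi, add_zero]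
    have h2 : (b * N + i) % N = i := by
      rw [mul_comm, Nat.mul_add_mod, Nat.mod_eq_of_lt hi]
    simp [hxs, h1, h2, hb]
  have hx0 : ∀ b, xs (b * N) = x := by
    intro b
    by_cases hb : IsSquare b
    · simpa [hQ0] using hxQ b 0 hN hb
    · simpa [hP0] using hxP b 0 hN hb
  obtain ⟨p, hp⟩ := hsh xs (fun t => by
    obtain ⟨b, i, hi, rfl⟩ : ∃ b i, i < N ∧ t = b * N + i :=
      ⟨t / N, t % N, Nat.mod_lt _ hN, (Nat.div_add_mod' t N).symm⟩
    rcases Nat.lt_or_ge (i + 1) N with hi1 | hi1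
    · by_cases hb : IsSquare b
      · rw [hxQ b i hi hb, add_assoc, hxQ b (i + 1) hi1 hb]
        exact hQ.2 i hi
      · rw [hxP b i hi hb, add_assoc, hxP b (i + 1) hi1 hb]
        exact hP.2 i hi
    · have hiN : i + 1 = N := by omega
      have h1 : xs (b * N + i + 1) = x := by
        rw [add_assoc, hiN, ← Nat.succ_mul, hx0]
      rw [h1]
      by_cases hb : IsSquare b
      · rw [hxQ b i hi hb, ← hQN]
        simpa [hiN] using hQ.2 i hi
      · rw [hxP b i hi hb, ← hPN]
        simpa [hiN] using hP.2 i hi) (by simpa using hx0 0)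
  have hnsq : ∀ m j : ℕ, 1 ≤ j → j ≤ 2 * m → ¬ IsSquare (m * m + j) := by
    rintro m j hj hjm ⟨r, hr⟩
    rcases le_or_gt r m with h | h
    · nlinarith
    · nlinarith
  have hsq : StrictMono fun m : ℕ => m * m := fun _ _ h => Nat.mul_self_lt_mul_self h
  obtain ⟨q, hq, hqlim⟩ := exists_mem_omegaLimitPt_of_strictMono hf p
    (t := fun m => (m * m + 1) * N) (fun a b hab => by
      have := hsq hab
      exact Nat.mul_lt_mul_of_pos_right (Nat.add_lt_add_right this 1) hN)
  obtain ⟨r, hr, hrlim⟩ := exists_mem_omegaLimitPt_of_strictMono hf p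
    (t := fun m => (m * m + 2 * m) * N) (fun a b hab => by
      have := hsq hab
      refine Nat.mul_lt_mul_of_pos_right ?_ hN
      simp only at this
      omega)
  have hqP : ∀ i, dist (P (i % N)) (f^[i] q) ≤ η := by
    intro i
    refine hqlim i _ _ ?_
    filter_upwards [eventually_ge_atTop (i / N + 1)] with m hm
    have h1 := hp ((m * m + 1) * N + i)
    have h2 : (m * m + 1) * N + i = (m * m + (1 + i / N)) * N + i % N := by
      have := Nat.div_add_mod' i N
      nlinarith
    have h3 := hxP (m * m + (1 + i / N)) (i % N) (Nat.mod_lt _ hN)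
      (hnsq m _ (Nat.le_add_right 1 _) (by rw [add_comm]; omega))
    rwa [h2, h3, ← h2] at h1
  have hrP : dist (P n) (f^[n] r) ≤ η := by
    refine hrlim n _ _ ?_
    filter_upwards [eventually_ge_atTop 1] with m hm
    have h1 := hp ((m * m + 2 * m) * N + n)
    rwa [hxP _ n hn (hnsq m _ (by omega) le_rfl)] at h1
  have hrQ : dist (Q n) (f^[N + n] r) ≤ η := by
    refine hrlim (N + n) _ _ (Eventually.of_forall fun m => ?_)
    have h1 := hp ((m * m + 2 * m) * N + (N + n))
    have h2 : (m * m + 2 * m) * N + (N + n) = ((m + 1) * (m + 1)) * N + n := by ring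
    have h3 := hxQ ((m + 1) * (m + 1)) n hn ⟨m + 1, rfl⟩
    rwa [h2, h3, ← h2] at h1
  obtain ⟨φ, -, hφ⟩ := hmin p q hq hr
  have hev : ∀ i, ∀ᶠ j in atTop, dist (f^[i] (f^[φ j] q)) (f^[i] r) < η := fun i =>
    Metric.tendsto_nhds.1 (((hf.iterate i).tendsto r).comp hφ) η hη
  obtain ⟨j, hj1, hj2⟩ := ((hev n).and (hev (N + n))).exists
  rw [← Function.iterate_add_apply] at hj1 hj2
  have hq1 := hqP (n + φ j)
  have hq2 := hqP (N + n + φ j)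
  rw [add_assoc, Nat.add_mod_left, ← add_assoc] at hq2
  have t1 := dist_triangle4 (P n) (f^[n] r) (f^[n + φ j] q) (P ((n + φ j) % N))
  have t2 := dist_triangle4 (Q n) (f^[N + n] r) (f^[N + n + φ j] q) (P ((n + φ j) % N))
  have t3 := dist_triangle_right (P n) (Q n) (P ((n + φ j) % N))
  rw [dist_comm] at hj1 hj2 hq1 hq2
  linarith

end Chains

section ChainContinuity

variable {f : X → X}

theorem chainContinuousAt_of_mem_omegaLimitPt_self [CompactSpace X] (hf : Continuous f)
    (hsh : ∀ x : X, ShadowablePoint f x) (hl : ∀ x : X, LSCPoint f x) {x : X}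
    (hx : x ∈ omegaLimitPt f x) : ChainContinuousAt f x := by
  have hreach : ∀ {y w}, ChainReach f y w → omegaLimitPt f y ⊆ omegaLimitPt f w :=
    fun {y _} h => h.omegaLimitPt_subset (hsh y) (hl y)
  by_contra hcon
  unfold ChainContinuousAt at hcon
  push Not at hcon
  obtain ⟨ε, hε, hcon⟩ := hcon
  choose c hc hc0 n hn using fun k : ℕ =>
    hcon (1 / ((k : ℝ) + 1)) Nat.one_div_pos_of_nat
  have hn1 : ∀ k, 1 ≤ n k := by
    intro k
    by_contra h
    have h0 : n k = 0 := by omega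
    have := hn k
    simp [h0, hc0] at this
    linarith
  obtain ⟨⟨u, v⟩, ψ, hψ, huv⟩ :=
    CompactSpace.tendsto_subseq (fun k => (f^[n k] x, c k (n k)))
  have hu : Tendsto (fun k => f^[n (ψ k)] x) atTop (𝓝 u) := (continuous_fst.tendsto _).comp huv
  have hv : Tendsto (fun k => c (ψ k) (n (ψ k))) atTop (𝓝 v) :=
    (continuous_snd.tendsto _).comp huv
  have hd : ε ≤ dist v u :=
    ge_of_tendsto (hv.dist hu) (Eventually.of_forall fun k => (hn (ψ k)).le)
  have he : Tendsto (fun k => 1 / ((ψ k : ℝ) + 1)) atTop (𝓝 0) :=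
    tendsto_one_div_add_atTop_nhds_zero_nat.comp hψ.tendsto_atTop
  have hcu : ∀ {δ : ℝ}, 0 < δ → ∀ᶠ k in atTop,
      ∃ d : ℕ → X, IsDeltaChain f δ d (n (ψ k)) ∧ d 0 = x ∧ d (n (ψ k)) = u := fun hδ =>
    exists_isDeltaChain_of_tendsto (c := fun _ i => f^[i] x) (e := fun _ => 0)
      (fun k => isDeltaChain_iterate le_rfl x (hn1 (ψ k))) (fun _ => rfl)
      tendsto_const_nhds hu hδ
  have hcv : ∀ {δ : ℝ}, 0 < δ → ∀ᶠ k in atTop,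
      ∃ d : ℕ → X, IsDeltaChain f δ d (n (ψ k)) ∧ d 0 = x ∧ d (n (ψ k)) = v := fun hδ =>
    exists_isDeltaChain_of_tendsto (c := fun k => c (ψ k))
      (fun k => ⟨hn1 (ψ k), fun i _ => hc (ψ k) i⟩) (fun k => hc0 (ψ k)) he hv hδ
  have hxu : ChainReach f x u := fun δ hδ => by
    obtain ⟨k, d, hd⟩ := (hcu hδ).exists
    exact ⟨d, _, hd⟩
  have hxv : ChainReach f x v := fun δ hδ => by
    obtain ⟨k, d, hd⟩ := (hcv hδ).exists
    exact ⟨d, _, hd⟩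
  obtain ⟨δ, hδ, hshδ⟩ := hsh x (ε / 7) (by positivity)
  obtain ⟨k, ⟨A, hA, hA0, hAu⟩, ⟨B, hB, hB0, hBv⟩⟩ := ((hcu hδ).and (hcv hδ)).exists
  obtain ⟨A', a, hA', hA'0, hA'x⟩ := chainReach_of_mem_omegaLimitPt (hreach hxu hx) δ hδ
  obtain ⟨B', b, hB', hB'0, hB'x⟩ := chainReach_of_mem_omegaLimitPt (hreach hxv hx) δ hδ
  obtain ⟨C, hCA, hCx, hC⟩ := hA.append hA' (hAu.trans hA'0.symm)
  obtain ⟨D, hDB, hDx, hD⟩ := hB.append hB' (hBv.trans hB'0.symm)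
  have hC0 : C 0 = x := (hCA 0 (Nat.zero_le _)).trans hA0
  have hD0 : D 0 = x := (hDB 0 (Nat.zero_le _)).trans hB0
  obtain ⟨P, hPC, hPx, hP⟩ := hC.append hD ((hCx.trans hA'x).trans hD0.symm)
  obtain ⟨Q, hQD, hQx, hQ⟩ := hD.append hC ((hDx.trans hB'x).trans hC0.symm)
  rw [add_comm (n (ψ k) + b)] at hQ hQx
  have hk := hn1 (ψ k)
  have key := dist_cycles_le hf
    (fun p q hq => hreach (chainReach_of_mem_omegaLimitPt hq)) (by positivity) hshδ hP hQ
    ((hPC 0 (Nat.zero_le _)).trans hC0) (hPx.trans (hDx.trans hB'x))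
    ((hQD 0 (Nat.zero_le _)).trans hD0) (hQx.trans (hCx.trans hA'x))
    (n := n (ψ k)) (by omega)
  rw [hPC _ (by omega), hCA _ le_rfl, hQD _ (by omega), hDB _ le_rfl, hAu, hBv,
    dist_comm] at key
  linarith

/-- Fine pseudo orbits follow the true orbit for a prescribed finite time. -/
theorem exists_pseudoOrbit_dist_iterate_le (hf : Continuous f) (x : X) (T : ℕ) :
    ∀ ε > 0, ∃ δ > 0, ∀ xs : ℕ → X, (∀ i, dist (f (xs i)) (xs (i + 1)) ≤ δ) →
      xs 0 = x → ∀ i ≤ T, dist (xs i) (f^[i] x) ≤ ε := by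
  induction T with
  | zero =>
    intro ε hε
    refine ⟨1, one_pos, fun xs _ h0 i hi => ?_⟩
    obtain rfl : i = 0 := by omega
    simpa [h0] using hε.le
  | succ T ih =>
    intro ε hε
    obtain ⟨ρ, hρ, hcont⟩ :=
      Metric.continuousAt_iff.1 (hf.continuousAt (x := f^[T] x)) (ε / 2) (half_pos hε)
    obtain ⟨δ, hδ, h⟩ := ih (min ε (ρ / 2)) (lt_min hε (half_pos hρ))
    refine ⟨min δ (ε / 2), lt_min hδ (half_pos hε), fun xs hxs h0 i hi => ?_⟩
    have hT := h xs (fun i => (hxs i).trans (min_le_left _ _)) h0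
    rcases Nat.lt_or_ge T i with hTi | hTi
    · obtain rfl : i = T + 1 := by omega
      have h1 := hcont (x := xs T) (((hT T le_rfl).trans (min_le_right _ _)).trans_lt (by linarith))
      have h2 := (hxs T).trans (min_le_right _ _)
      rw [Function.iterate_succ_apply']
      have := dist_triangle_left (xs (T + 1)) (f (f^[T] x)) (f (xs T))
      linarith
    · exact (hT i hTi).trans (min_le_left _ _)

theorem ChainContinuousAt.of_mem_omegaLimitPt (hf : Continuous f) {x z : X}
    (hz : z ∈ omegaLimitPt f x) (h : ChainContinuousAt f z) : ChainContinuousAt f x := by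
  intro ε hε
  obtain ⟨δ₀, hδ₀, hcc⟩ := h (ε / 2) (half_pos hε)
  obtain ⟨ρ, hρ, hcont⟩ :=
    Metric.continuousAt_iff.1 (hf.continuousAt (x := z)) (δ₀ / 2) (half_pos hδ₀)
  obtain ⟨T, -, hT⟩ := mem_omegaLimitPt_iff.1 hz ρ hρ 0
  obtain ⟨δ, hδ, htrack⟩ := exists_pseudoOrbit_dist_iterate_le hf x (T + 1)
    (min ε (δ₀ / 2)) (lt_min hε (half_pos hδ₀))
  have follow : ∀ xs : ℕ → X, (∀ i, dist (f (xs i)) (xs (i + 1)) ≤ min δ δ₀) → xs 0 = x →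
      ∀ i, dist (xs (T + (i + 1))) (f^[i + 1] z) ≤ ε / 2 := by
    intro xs hxs h0 i
    refine hcc (fun j => if j = 0 then z else xs (T + j)) (fun j => ?_) (if_pos rfl) (i + 1)
    rcases Nat.eq_zero_or_pos j with rfl | hj
    · have h1 := hcont hT
      have h2 := (htrack xs (fun i => (hxs i).trans (min_le_left _ _)) h0 (T + 1) le_rfl).trans
        (min_le_right _ _)
      rw [Function.iterate_succ_apply'] at h2
      have h3 := dist_triangle_left (f z) (xs (T + 1)) (f (f^[T] x))
      rw [dist_comm (f (f^[T] x)) (xs _)] at h3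
      simpa using h3.trans (by linarith)
    · simpa [hj.ne', ← add_assoc] using (hxs (T + j)).trans (min_le_right _ _)
  refine ⟨min δ δ₀, lt_min hδ hδ₀, fun xs hxs h0 i => ?_⟩
  rcases Nat.lt_or_ge T i with hi | hi
  · obtain ⟨j, rfl⟩ : ∃ j, i = T + (j + 1) := ⟨i - T - 1, by omega⟩
    have h1 := follow xs hxs h0 j
    have h2 := follow (fun i => f^[i] x)
      (fun i => by simpa [Function.iterate_succ_apply'] using ⟨hδ.le, hδ₀.le⟩) rfl j
    have := dist_triangle_right (xs (T + (j + 1))) (f^[T + (j + 1)] x) (f^[j + 1] z)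
    linarith
  · exact (htrack xs (fun i => (hxs i).trans (min_le_left _ _)) h0 i (by omega)).trans
      (min_le_left _ _)

theorem ChainContinuousAt.lscPoint [CompactSpace X] (hf : Continuous f) {x : X}
    (h : ChainContinuousAt f x) : LSCPoint f x := by
  rintro U hU ⟨a, ha, haU⟩
  obtain ⟨ε, hε, hball⟩ := Metric.isOpen_iff.1 hU a haU
  obtain ⟨δ, hδ, hcc⟩ := h (ε / 2) (half_pos hε)
  obtain ⟨ρ, hρ, hcont⟩ := Metric.continuousAt_iff.1 (hf.continuousAt (x := x)) δ hδ
  refine ⟨ρ / 2, half_pos hρ, fun y hy => ?_⟩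
  have hfy : dist (f x) (f y) ≤ δ := by
    rw [dist_comm]
    exact (hcont (by rw [dist_comm]; linarith)).le
  have hclose : ∀ i, dist (f^[i + 1] x) (f^[i + 1] y) ≤ ε / 2 := fun i => by
    rw [dist_comm]
    refine hcc (fun j => if j = 0 then x else f^[j] y) (fun j => ?_) (if_pos rfl) (i + 1)
    rcases Nat.eq_zero_or_pos j with rfl | hj
    · simpa using hfy
    · simp only [hj.ne', if_false, Nat.add_eq_zero_iff, one_ne_zero, and_false]
      rw [Function.iterate_succ_apply', dist_self]
      exact hδ.le
  obtain ⟨b, hb, hab⟩ := exists_mem_omegaLimitPt_dist_le hclose ha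
  exact ⟨b, hb, hball (by rw [Metric.mem_ball, dist_comm]; linarith)⟩

end ChainContinuity

theorem stmt11 [CompactSpace X] (f : X → X) (hf : Continuous f)
    (hsh : ∀ x : X, ShadowablePoint f x) :
    (∀ x : X, LSCPoint f x) ↔ (∀ x : X, ChainContinuousAt f x) := by
  refine ⟨fun hl x => ?_, fun h x => (h x).lscPoint hf⟩
  obtain ⟨z, φ, hφ, hz⟩ := CompactSpace.tendsto_subseq (fun n => f^[n] x)
  have hzx : z ∈ omegaLimitPt f x := ⟨φ, hφ, hz⟩
  have hzz : z ∈ omegaLimitPt f z :=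
    (chainReach_of_mem_omegaLimitPt hzx).omegaLimitPt_subset (hsh x) (hl x) hzx
  exact (chainContinuousAt_of_mem_omegaLimitPt_self hf hsh hl hzz).of_mem_omegaLimitPt hf hzx
end
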